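/- Let E be a centrally orthocomplete pseudo-effect algebra, let (cᵢ)_{i∈I} be a family of pairwise disjoint central elements of E, and let (eᵢ)_{i∈I}, (fᵢ)_{i∈I} be families in E such that eᵢ, fᵢ ≤ cᵢ and eᵢ + fᵢ exists for every i ∈ I. Then: (i) c := ⋁_{i∈I} cᵢ, e := ⋁_{i∈I} eᵢ ≤ c and f := ⋁_{i∈I} fᵢ ≤ c all exist, and e + f exists; (ii) e + f = ⋁_{i∈I}(eᵢ + fᵢ) ≤ c. -/

import Mathlib

namespace PEApaper

/-- The bare data of a partial-addition structure: a partial binary operation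
(encoded via `Option`) together with constants `0` and `1`. -/
structure PartialStruct (E : Type) where
  padd : E → E → Option E
  zero : E
  one : E

namespace PartialStruct

variable {E : Type}

/-- `a ≤ b` iff `a + c = b` for some `c`. -/
def le (P : PartialStruct E) (a b : E) : Prop := ∃ c, P.padd a c = some b

/-- `m` is the greatest lower bound (meet `a ∧ b`) of `a` and `b`. -/
def IsMeet (P : PartialStruct E) (a b m : E) : Prop :=
  P.le m a ∧ P.le m b ∧ ∀ x, P.le x a → P.le x b → P.le x m

/-- `j` is the least upper bound (join `a ∨ b`) of `a` and `b`. -/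
def IsJoin (P : PartialStruct E) (a b j : E) : Prop :=
  P.le a j ∧ P.le b j ∧ ∀ x, P.le a x → P.le b x → P.le j x

/-- `s` is the supremum of the set `S`. -/
def IsSup (P : PartialStruct E) (S : Set E) (s : E) : Prop :=
  (∀ x ∈ S, P.le x s) ∧ ∀ u, (∀ x ∈ S, P.le x u) → P.le s u

/-- Left-associated partial sum of a list, continuing from `acc`. -/
def IsSumFrom (P : PartialStruct E) : E → List E → E → Prop
  | acc, [], s => s = acc
  | acc, a :: l, s => ∃ t, P.padd acc a = some t ∧ IsSumFrom P t l s

/-- `s` is the (left-associated) orthosum `e₁ + e₂ + ⋯ + eₙ` of the list. -/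
def IsSumList (P : PartialStruct E) (l : List E) (s : E) : Prop :=
  match l with
  | [] => s = P.zero
  | a :: t => IsSumFrom P a t s

/-- `c` is a central element: there is a PEA-isomorphism
`f : E → E[0,c] × E[0,c∼]` with `f c = (c,0)` such that `f x = (x₁,x₂)`
implies `x = x₁ + x₂`.  The isomorphism onto the product of the two
interval pseudo-effect algebras is spelled out explicitly. -/
def IsCentral (P : PartialStruct E) (c : E) : Prop :=
  ∃ cs, P.padd c cs = some P.one ∧
    ∃ f : E → E × E,
      (∀ x, P.le (f x).1 c ∧ P.le (f x).2 cs) ∧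
      Function.Injective f ∧
      (∀ y : E × E, P.le y.1 c → P.le y.2 cs → ∃ x, f x = y) ∧
      f c = (c, P.zero) ∧
      f P.one = (c, cs) ∧
      (∀ x, P.padd (f x).1 (f x).2 = some x) ∧
      (∀ a b ab, P.padd a b = some ab →
        P.padd (f a).1 (f b).1 = some (f ab).1 ∧
        P.padd (f a).2 (f b).2 = some (f ab).2) ∧
      (∀ a b s t, P.padd (f a).1 (f b).1 = some s → P.le s c →
        P.padd (f a).2 (f b).2 = some t → P.le t cs →
        ∃ ab, P.padd a b = some ab)

/-- The center `Γ(E)`. -/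
def center (P : PartialStruct E) : Set E := {c | P.IsCentral c}

/-- The central interval `Γ(E)[0,c] = Γ(E) ∩ E[0,c]`. -/
def centerIntervalSet (P : PartialStruct E) (c : E) : Set E :=
  {x | P.IsCentral x ∧ P.le x c}

/-- A Γ-orthogonal family: one dominated elementwise by a pairwise
disjoint family of central elements. -/
def GammaOrthogonal (P : PartialStruct E) {I : Type} (e : I → E) : Prop :=
  ∃ c : I → E, (∀ i, P.IsCentral (c i)) ∧
    (∀ i j, i ≠ j → P.IsMeet (c i) (c j) P.zero) ∧
    ∀ i, P.le (e i) (c i)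

/-- Centrally orthocomplete: every Γ-orthogonal family has a supremum. -/
def IsCOPEA (P : PartialStruct E) : Prop :=
  ∀ (I : Type) (e : I → E), P.GammaOrthogonal e → ∃ s, P.IsSup (Set.range e) s

/-- `c` is the central cover of `e`: the smallest central element above `e`. -/
def IsCentralCover (P : PartialStruct E) (c e : E) : Prop :=
  P.IsCentral c ∧ P.le e c ∧ ∀ d, P.IsCentral d → P.le e d → P.le c d

/-- `[Q]`: the set of all suprema of Γ-orthogonal families of elements of `Q`. -/
def bra (P : PartialStruct E) (Q : Set E) : Set E :=
  {s | ∃ (I : Type) (e : I → E), (∀ i, e i ∈ Q) ∧ P.GammaOrthogonal e ∧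
    P.IsSup (Set.range e) s}

/-- `Q^γ = {q ∧ c : q ∈ Q, c ∈ Γ(E)}`. -/
def gammaClosure (P : PartialStruct E) (Q : Set E) : Set E :=
  {m | ∃ q ∈ Q, ∃ c, P.IsCentral c ∧ P.IsMeet q c m}

/-- `Q↓ = ⋃_{q ∈ Q} E[0,q]`. -/
def downSet (P : PartialStruct E) (Q : Set E) : Set E :=
  {e | ∃ q ∈ Q, P.le e q}

/-- `Q' = {e ∈ E : q ∧ e = 0 for all q ∈ Q}`. -/
def commutant (P : PartialStruct E) (Q : Set E) : Set E :=
  {e | ∀ q ∈ Q, P.IsMeet q e P.zero}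

/-- A type-determining (TD) set: `K = [K] = K^γ`. -/
def IsTD (P : PartialStruct E) (K : Set E) : Prop :=
  P.bra K = K ∧ P.gammaClosure K = K

/-- A strongly type-determining (STD) set: `K = [K] = K↓`. -/
def IsSTD (P : PartialStruct E) (K : Set E) : Prop :=
  P.bra K = K ∧ P.downSet K = K

/-- `c` is the type-cover of `K` (w.r.t. the central cover map `γ`):
the unique central element with `γK = Γ(E)[0,c]`. -/
def IsTypeCover (P : PartialStruct E) (γ : E → E) (K : Set E) (c : E) : Prop :=
  P.IsCentral c ∧ γ '' K = P.centerIntervalSet c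

/-- An atom: a nonzero element with no proper nonzero subelement. -/
def IsAtom' (P : PartialStruct E) (a : E) : Prop :=
  a ≠ P.zero ∧ ∀ x, P.le x a → x = P.zero ∨ x = a

end PartialStruct

/-- A PEA-isomorphism between two partial-addition structures: a bijective
morphism whose inverse is a morphism. -/
structure IsPEAIso {A B : Type} (P : PartialStruct A) (Q : PartialStruct B)
    (f : A → B) : Prop where
  bijective : Function.Bijective f
  map_one : f P.one = Q.one
  map_add : ∀ a b ab, P.padd a b = some ab → Q.padd (f a) (f b) = some (f ab)
  rev_add : ∀ a b s, Q.padd (f a) (f b) = some s → ∃ ab, P.padd a b = some ab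

open scoped Classical in
/-- The (coordinatewise) product of a family of partial structures. -/
noncomputable def prodStruct {I : Type} {A : I → Type}
    (Ps : ∀ i, PartialStruct (A i)) : PartialStruct (∀ i, A i) where
  padd a b :=
    if h : ∀ i, ∃ s, (Ps i).padd (a i) (b i) = some s
    then some fun i => Classical.choose (h i)
    else none
  zero := fun i => (Ps i).zero
  one := fun i => (Ps i).one

/-- A pseudo-effect algebra. -/
structure PEA (E : Type) extends PartialStruct E where
  assoc_def : ∀ a b c : E,
    (∃ ab, padd a b = some ab ∧ ∃ x, padd ab c = some x) ↔
    (∃ bc, padd b c = some bc ∧ ∃ y, padd a bc = some y)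
  assoc_eq : ∀ a b c ab bc x y, padd a b = some ab → padd ab c = some x →
    padd b c = some bc → padd a bc = some y → x = y
  exu_right : ∀ a : E, ∃! d, padd a d = some one
  exu_left : ∀ a : E, ∃! e, padd e a = some one
  shift : ∀ a b ab, padd a b = some ab →
    (∃ d, padd d a = some ab) ∧ (∃ e, padd b e = some ab)
  one_add : ∀ a x, padd one a = some x → a = zero
  add_one : ∀ a x, padd a one = some x → a = zero

namespace PEA

variable {E : Type} (P : PEA E)

/-- Shorthand for the underlying partial structure. -/
abbrev ps : PartialStruct E := P.toPartialStruct

theorem one_add_zero : P.padd P.one P.zero = some P.one := by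
  obtain ⟨d, hd, -⟩ := P.exu_right P.one
  have h := P.one_add d P.one hd
  rwa [h] at hd

theorem zero_add_one : P.padd P.zero P.one = some P.one := by
  obtain ⟨e, he, -⟩ := P.exu_left P.one
  have h := P.add_one e P.one he
  rwa [h] at he

theorem padd_zero (a : E) : P.padd a P.zero = some a := by
  obtain ⟨e, he, -⟩ := P.exu_left a
  have h1 : ∃ ab, P.padd e a = some ab ∧ ∃ x, P.padd ab P.zero = some x :=
    ⟨P.one, he, P.one, P.one_add_zero⟩
  obtain ⟨t, ht, y, hy⟩ := (P.assoc_def e a P.zero).mp h1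
  have hxy : P.one = y :=
    P.assoc_eq e a P.zero P.one t P.one y he P.one_add_zero ht hy
  obtain ⟨d, hd, hu⟩ := P.exu_right e
  have hta : t = a := by
    have h2 : t = d := hu t (by rw [← hxy] at hy; exact hy)
    have h3 : a = d := hu a he
    rw [h2, h3]
  rwa [hta] at ht

theorem zero_padd (a : E) : P.padd P.zero a = some a := by
  obtain ⟨d, hd, -⟩ := P.exu_right a
  have h1 : ∃ bc, P.padd a d = some bc ∧ ∃ y, P.padd P.zero bc = some y :=
    ⟨P.one, hd, P.one, P.zero_add_one⟩
  obtain ⟨t, ht, y, hy⟩ := (P.assoc_def P.zero a d).mpr h1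
  have hxy : y = P.one :=
    P.assoc_eq P.zero a d t P.one y P.one ht hy hd P.zero_add_one
  obtain ⟨e, he, hu⟩ := P.exu_left d
  have hta : t = a := by
    have h2 : t = e := hu t (by rw [hxy] at hy; exact hy)
    have h3 : a = e := hu a hd
    rw [h2, h3]
  rwa [hta] at ht

theorem zero_le (a : E) : P.ps.le P.zero a := ⟨a, P.zero_padd a⟩

theorem le_refl (a : E) : P.ps.le a a := ⟨P.zero, P.padd_zero a⟩

open scoped Classical in
/-- The interval pseudo-effect algebra `E[0,p]` as a partial structure on
the subtype `{x // x ≤ p}`; the sum is defined iff it is defined in `E`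
and lies below `p`, and the unit is `p`. -/
noncomputable def intervalStruct (p : E) :
    PartialStruct {x : E // P.ps.le x p} where
  padd a b := (P.padd a.1 b.1).bind fun s =>
    if h : P.ps.le s p then some ⟨s, h⟩ else none
  zero := ⟨P.zero, P.zero_le p⟩
  one := ⟨p, P.le_refl p⟩

end PEA

/-- The order relation of a complete Boolean algebra structure, made explicit. -/
def cbaLe {X : Type} (inst : CompleteBooleanAlgebra X) (a b : X) : Prop :=
  @LE.le X (by letI := inst; exact inferInstance) a b

end PEApaper

namespace PEApaper.PEA

variable {E : Type} (P : PEA E)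

theorem padd_assoc_right {a b c ab x : E} (h : P.padd a b = some ab)
    (h' : P.padd ab c = some x) : ∃ bc, P.padd b c = some bc ∧ P.padd a bc = some x := by
  obtain ⟨bc, hbc, y, hy⟩ := (P.assoc_def a b c).mp ⟨ab, h, x, h'⟩
  exact ⟨bc, hbc, P.assoc_eq a b c ab bc x y h h' hbc hy ▸ hy⟩

theorem padd_assoc_left {a b c bc x : E} (h : P.padd b c = some bc)
    (h' : P.padd a bc = some x) : ∃ ab, P.padd a b = some ab ∧ P.padd ab c = some x := by
  obtain ⟨ab, hab, y, hy⟩ := (P.assoc_def a b c).mpr ⟨bc, h, x, h'⟩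
  exact ⟨ab, hab, P.assoc_eq a b c ab bc y x hab hy h h' ▸ hy⟩

theorem padd_left_cancel {a b c x : E} (hb : P.padd a b = some x)
    (hc : P.padd a c = some x) : b = c := by
  obtain ⟨y, hy, -⟩ := P.exu_left x
  obtain ⟨u, hu, hu'⟩ := P.padd_assoc_left hb hy
  obtain ⟨v, hv, hv'⟩ := P.padd_assoc_left hc hy
  obtain rfl : u = v := Option.some.inj (hu.symm.trans hv)
  exact (P.exu_right u).unique hu' hv'

theorem eq_zero_of_padd_eq_zero {a b : E} (h : P.padd a b = some P.zero) : a = P.zero := by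
  obtain ⟨u, hu, -⟩ := P.padd_assoc_left h P.one_add_zero
  exact P.one_add a u hu

theorem le_trans {a b c : E} (hab : P.ps.le a b) (hbc : P.ps.le b c) : P.ps.le a c := by
  obtain ⟨x, hx⟩ := hab
  obtain ⟨y, hy⟩ := hbc
  obtain ⟨z, -, hz⟩ := P.padd_assoc_right hx hy
  exact ⟨z, hz⟩

theorem le_antisymm {a b : E} (hab : P.ps.le a b) (hba : P.ps.le b a) : a = b := by
  obtain ⟨x, hx⟩ := hab
  obtain ⟨y, hy⟩ := hba
  obtain ⟨z, hz, hz'⟩ := P.padd_assoc_right hx hy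
  obtain rfl := P.padd_left_cancel hz' (P.padd_zero a)
  obtain rfl := P.eq_zero_of_padd_eq_zero hz
  exact Option.some.inj ((P.padd_zero a).symm.trans hx)

theorem le_zero {a : E} (h : P.ps.le a P.zero) : a = P.zero :=
  P.le_antisymm h (P.zero_le a)

theorem le_padd_right {a b s : E} (h : P.padd a b = some s) : P.ps.le b s :=
  (P.shift a b s h).2

theorem padd_mono_right {a b c s t : E} (hbc : P.ps.le b c) (hs : P.padd a b = some s)
    (ht : P.padd a c = some t) : P.ps.le s t := by
  obtain ⟨x, hx⟩ := hbc
  obtain ⟨u, hu, hu'⟩ := P.padd_assoc_left hx ht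
  obtain rfl : s = u := Option.some.inj (hs.symm.trans hu)
  exact ⟨x, hu'⟩

theorem padd_mono_left {a b c s t : E} (hab : P.ps.le a b) (hs : P.padd a c = some s)
    (ht : P.padd b c = some t) : P.ps.le s t := by
  obtain ⟨x, hx⟩ := hab
  obtain ⟨y, hy⟩ := (P.shift a x b hx).1
  obtain ⟨u, hu, hu'⟩ := P.padd_assoc_right hy ht
  obtain rfl : s = u := Option.some.inj (hs.symm.trans hu)
  exact P.le_padd_right hu'

theorem le_of_padd_le_padd_left {a b c s t : E} (hb : P.padd a b = some s)
    (hc : P.padd a c = some t) (hst : P.ps.le s t) : P.ps.le b c := by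
  obtain ⟨x, hx⟩ := hst
  obtain ⟨y, hy, hy'⟩ := P.padd_assoc_right hb hx
  exact ⟨x, P.padd_left_cancel hy' hc ▸ hy⟩

theorem exists_padd_iff_le_right {a b r : E} (hr : P.padd a r = some P.one) :
    (∃ s, P.padd a b = some s) ↔ P.ps.le b r := by
  constructor
  · rintro ⟨s, hs⟩
    obtain ⟨d, hd, -⟩ := P.exu_right s
    exact P.le_of_padd_le_padd_left hs hr ⟨d, hd⟩
  · rintro ⟨d, hd⟩
    obtain ⟨s, hs, -⟩ := P.padd_assoc_left hd hr
    exact ⟨s, hs⟩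

theorem exists_padd_iff_le_left {a b l : E} (hl : P.padd l b = some P.one) :
    (∃ s, P.padd a b = some s) ↔ P.ps.le a l := by
  constructor
  · rintro ⟨s, hs⟩
    obtain ⟨d, hd, -⟩ := P.exu_left s
    obtain ⟨u, hu, hu'⟩ := P.padd_assoc_left hs hd
    obtain rfl := (P.exu_left b).unique hu' hl
    exact P.le_padd_right hu
  · rintro ⟨d, hd⟩
    obtain ⟨x, hx⟩ := (P.shift a d l hd).1
    obtain ⟨s, hs, -⟩ := P.padd_assoc_right hx hl
    exact ⟨s, hs⟩

theorem exists_padd_of_isSup {S T : Set E} {s t : E} (hs : P.ps.IsSup S s)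
    (ht : P.ps.IsSup T t) (h : ∀ a ∈ S, ∀ b ∈ T, ∃ x, P.padd a b = some x) :
    ∃ x, P.padd s t = some x := by
  obtain ⟨l, hl, -⟩ := P.exu_left t
  refine (P.exists_padd_iff_le_left hl).mpr (hs.2 l fun a ha => ?_)
  obtain ⟨r, hr, -⟩ := P.exu_right a
  exact (P.exists_padd_iff_le_left hl).mp ((P.exists_padd_iff_le_right hr).mpr
    (ht.2 r fun b hb => (P.exists_padd_iff_le_right hr).mp (h a ha b hb)))

/-- The maps `p`, `q` are the two components of the decomposition of `E` given by the
central element `c`. -/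
structure IsDecomposition (c : E) (p q : E → E) : Prop where
  fst_le : ∀ x, P.ps.le (p x) c
  padd_eq : ∀ x, P.padd (p x) (q x) = some x
  fst_padd : ∀ {a b ab}, P.padd a b = some ab → P.padd (p a) (p b) = some (p ab)
  snd_padd : ∀ {a b ab}, P.padd a b = some ab → P.padd (q a) (q b) = some (q ab)
  snd_self : q c = P.zero
  surj : ∀ {a} (y), P.ps.le a c → ∃ w, p w = a ∧ q w = q y

theorem exists_isDecomposition {c : E} (hc : P.ps.IsCentral c) :
    ∃ p q, P.IsDecomposition c p q := by
  obtain ⟨cs, -, F, hle, -, hsurj, hFc, -, hsum, hadd, -⟩ := hc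
  refine ⟨fun x => (F x).1, fun x => (F x).2, fun x => (hle x).1, hsum,
    fun h => (hadd _ _ _ h).1, fun h => (hadd _ _ _ h).2, by simp [hFc], ?_⟩
  intro a y ha
  obtain ⟨w, hw⟩ := hsurj (a, (F y).2) ha (hle y).2
  exact ⟨w, by simp [hw], by simp [hw]⟩

namespace IsDecomposition

variable {P} {c : E} {p q : E → E} (D : P.IsDecomposition c p q)
include D

theorem fst_le_self (x : E) : P.ps.le (p x) x := ⟨q x, D.padd_eq x⟩

theorem snd_le_self (x : E) : P.ps.le (q x) x := P.le_padd_right (D.padd_eq x)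

theorem fst_mono {a b : E} (h : P.ps.le a b) : P.ps.le (p a) (p b) :=
  h.elim fun x hx => ⟨p x, D.fst_padd hx⟩

theorem snd_mono {a b : E} (h : P.ps.le a b) : P.ps.le (q a) (q b) :=
  h.elim fun x hx => ⟨q x, D.snd_padd hx⟩

theorem fst_eq_of_snd_eq_zero {x : E} (h : q x = P.zero) : p x = x := by
  have := D.padd_eq x
  rw [h, P.padd_zero] at this
  exact Option.some.inj this

theorem snd_eq_zero {x : E} (h : P.ps.le x c) : q x = P.zero :=
  P.le_zero (D.snd_self ▸ D.snd_mono h)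

theorem fst_eq {x : E} (h : P.ps.le x c) : p x = x :=
  D.fst_eq_of_snd_eq_zero (D.snd_eq_zero h)

theorem snd_eq_of_disjoint {d x : E} (hd : P.ps.IsMeet c d P.zero) (hx : P.ps.le x d) :
    q x = x := by
  have h0 : p x = P.zero :=
    P.le_zero (hd.2.2 _ (D.fst_le x) (P.le_trans (D.fst_le_self x) hx))
  have := D.padd_eq x
  rw [h0, P.zero_padd] at this
  exact Option.some.inj this

theorem padd_le {a b s : E} (ha : P.ps.le a c) (hb : P.ps.le b c)
    (h : P.padd a b = some s) : P.ps.le s c := by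
  have hs := D.snd_padd h
  rw [D.snd_eq_zero ha, D.snd_eq_zero hb, P.padd_zero] at hs
  exact D.fst_eq_of_snd_eq_zero (Option.some.inj hs).symm ▸ D.fst_le s

theorem exists_padd_of_disjoint {a b d : E} (ha : P.ps.le a c)
    (hd : P.ps.IsMeet c d P.zero) (hb : P.ps.le b d) : ∃ s, P.padd a b = some s := by
  obtain ⟨w, hw, hw'⟩ := D.surj b ha
  rw [D.snd_eq_of_disjoint hd hb] at hw'
  exact ⟨w, hw ▸ hw' ▸ D.padd_eq w⟩

end IsDecomposition

/-- The component under a central element `c i` of the supremum of a family dominated by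
pairwise disjoint elements `c j` is the `i`-th member of the family. -/
theorem IsDecomposition.fst_isSup_eq {P : PEA E} {I : Type} {c e : I → E} {s : E} {i : I}
    {p q : E → E} (D : P.IsDecomposition (c i) p q)
    (hdisj : ∀ j, i ≠ j → P.ps.IsMeet (c i) (c j) P.zero)
    (he : ∀ j, P.ps.le (e j) (c j)) (hs : P.ps.IsSup (Set.range e) s) : p s = e i := by
  obtain ⟨w, hw, hw'⟩ := D.surj s (he i)
  have hsw : P.ps.le s w := by
    refine hs.2 w (Set.forall_mem_range.mpr fun j => ?_)
    by_cases hij : i = j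
    · subst hij
      exact hw ▸ D.fst_le_self w
    · have h := D.snd_mono (hs.1 (e j) ⟨j, rfl⟩)
      rw [D.snd_eq_of_disjoint (hdisj j hij) (he j), ← hw'] at h
      exact P.le_trans h (D.snd_le_self w)
  refine P.le_antisymm (hw ▸ D.fst_mono hsw) ?_
  have h := D.fst_mono (hs.1 (e i) ⟨i, rfl⟩)
  rwa [D.fst_eq (he i)] at h

end PEApaper.PEA

open PEApaper PEApaper.PartialStruct in
/-- Theorem 4.5: in a COPEA, for a pairwise disjoint family `(cᵢ)` of central
elements and families `eᵢ, fᵢ ≤ cᵢ` with `eᵢ + fᵢ` defined: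
`c = ⋁ᵢ cᵢ`, `e = ⋁ᵢ eᵢ ≤ c`, `f = ⋁ᵢ fᵢ ≤ c` all exist, `e + f` exists, and
`e + f = ⋁ᵢ (eᵢ + fᵢ) ≤ c`. -/
theorem stmt6 {E I : Type} (P : PEA E) (hco : P.ps.IsCOPEA)
    (c e f : I → E) (hc : ∀ i, P.ps.IsCentral (c i))
    (hdisj : ∀ i j, i ≠ j → P.ps.IsMeet (c i) (c j) P.ps.zero)
    (he : ∀ i, P.ps.le (e i) (c i)) (hf : ∀ i, P.ps.le (f i) (c i))
    (g : I → E) (hg : ∀ i, P.ps.padd (e i) (f i) = some (g i)) :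
    ∃ cs es fs : E,
      P.ps.IsSup (Set.range c) cs ∧
      P.ps.IsSup (Set.range e) es ∧ P.ps.le es cs ∧
      P.ps.IsSup (Set.range f) fs ∧ P.ps.le fs cs ∧
      ∃ s, P.ps.padd es fs = some s ∧
        P.ps.IsSup (Set.range g) s ∧ P.ps.le s cs := by
  choose p q D using fun i => P.exists_isDecomposition (hc i)
  obtain ⟨cs, hcs⟩ := hco I c ⟨c, hc, hdisj, fun i => P.le_refl _⟩
  obtain ⟨es, hes⟩ := hco I e ⟨c, hc, hdisj, he⟩
  obtain ⟨fs, hfs⟩ := hco I f ⟨c, hc, hdisj, hf⟩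
  have le_cs : ∀ {x i}, P.ps.le x (c i) → P.ps.le x cs := fun {x i} h =>
    P.le_trans h (hcs.1 (c i) ⟨i, rfl⟩)
  have hef : ∀ i j, ∃ x, P.padd (e i) (f j) = some x := fun i j => by
    by_cases hij : i = j
    · exact hij ▸ ⟨g i, hg i⟩
    · exact (D i).exists_padd_of_disjoint (he i) (hdisj i j hij) (hf j)
  obtain ⟨s, hs⟩ := P.exists_padd_of_isSup hes hfs
    (Set.forall_mem_range.mpr fun i => Set.forall_mem_range.mpr fun j => hef i j)
  have hsup : P.ps.IsSup (Set.range g) s := by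
    refine ⟨Set.forall_mem_range.mpr fun i => ?_, fun u hu => ?_⟩
    · obtain ⟨l, hl, -⟩ := P.exu_left fs
      obtain ⟨t, ht⟩ := (P.exists_padd_iff_le_left hl).mpr <|
        P.le_trans (hes.1 (e i) ⟨i, rfl⟩) ((P.exists_padd_iff_le_left hl).mp ⟨s, hs⟩)
      exact P.le_trans (P.padd_mono_right (hfs.1 (f i) ⟨i, rfl⟩) (hg i) ht)
        (P.padd_mono_left (hes.1 (e i) ⟨i, rfl⟩) ht hs)
    · have hgu : ∀ i, P.ps.le (g i) u := fun i => hu (g i) ⟨i, rfl⟩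
      obtain ⟨r, hr⟩ := hes.2 u
        (Set.forall_mem_range.mpr fun i => P.le_trans ⟨f i, hg i⟩ (hgu i))
      refine P.padd_mono_right (hfs.2 r (Set.forall_mem_range.mpr fun i => ?_)) hs hr
      have hpr := (D i).fst_padd hr
      rw [(D i).fst_isSup_eq (hdisj i) he hes] at hpr
      have hgp := (D i).fst_mono (hgu i)
      rw [(D i).fst_eq ((D i).padd_le (he i) (hf i) (hg i))] at hgp
      exact P.le_trans (P.le_of_padd_le_padd_left (hg i) hpr hgp) ((D i).fst_le_self r)
  exact ⟨cs, es, fs, hcs,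
    hes, hes.2 cs (Set.forall_mem_range.mpr fun i => le_cs (he i)),
    hfs, hfs.2 cs (Set.forall_mem_range.mpr fun i => le_cs (hf i)),
    s, hs, hsup,
    hsup.2 cs (Set.forall_mem_range.mpr fun i =>
      le_cs ((D i).padd_le (he i) (hf i) (hg i)))⟩
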